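/- For every real x > 0, one has √x ≤ Γ(x+1)/Γ(x+1/2) ≤ √(x + 1/2), where Γ is the real Gamma function. -/

import Mathlib

open MeasureTheory ProbabilityTheory Matrix Real

/-- The Euler Beta function `B(a,b) = Γ(a)Γ(b)/Γ(a+b)`. -/
noncomputable def betaB (a b : ℝ) : ℝ := Real.Gamma a * Real.Gamma b / Real.Gamma (a + b)

/-- The density of the Beta(a,b) distribution. -/
noncomputable def betaPdf (a b x : ℝ) : ℝ :=
  if 0 < x ∧ x < 1 then x ^ (a - 1) * (1 - x) ^ (b - 1) / betaB a b else 0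

/-- The Beta(a,b) distribution on ℝ. -/
noncomputable def betaMeasure (a b : ℝ) : Measure ℝ :=
  MeasureTheory.volume.withDensity fun x => ENNReal.ofReal (betaPdf a b x)

theorem gamma_add_half_le_sqrt_mul_gamma {s : ℝ} (hs : 0 < s) :
    Real.Gamma (s + 1 / 2) ≤ √s * Real.Gamma s := by
  have hG := Real.Gamma_pos_of_pos hs
  have h := Real.Gamma_mul_add_mul_le_rpow_Gamma_mul_rpow_Gamma hs (by linarith : 0 < s + 1)
    one_half_pos one_half_pos (add_halves 1)
  rw [← Real.sqrt_eq_rpow, ← Real.sqrt_eq_rpow, Real.Gamma_add_one hs.ne', Real.sqrt_mul hs.le,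
    mul_left_comm, Real.mul_self_sqrt hG.le] at h
  convert h using 2
  ring

theorem gamma_ratio_bounds (x : ℝ) (hx : 0 < x) :
    Real.sqrt x ≤ Real.Gamma (x + 1) / Real.Gamma (x + 1 / 2) ∧
    Real.Gamma (x + 1) / Real.Gamma (x + 1 / 2) ≤ Real.sqrt (x + 1 / 2) := by
  have hG : 0 < Real.Gamma (x + 1 / 2) := Real.Gamma_pos_of_pos (by linarith)
  rw [le_div_iff₀ hG, div_le_iff₀ hG]
  constructor
  · calc √x * Real.Gamma (x + 1 / 2) ≤ √x * (√x * Real.Gamma x) := by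
          gcongr
          exact gamma_add_half_le_sqrt_mul_gamma hx
      _ = Real.Gamma (x + 1) := by
          rw [← mul_assoc, Real.mul_self_sqrt hx.le, Real.Gamma_add_one hx.ne']
  · have h := gamma_add_half_le_sqrt_mul_gamma (by linarith : 0 < x + 1 / 2)
    rwa [add_assoc, add_halves] at h
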